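/- Let 𝒳 be a finite set and d ≥ 1. Let ρ be a positive semidefinite matrix on ℂ^𝒳 ⊗ ℂ^d with Tr[ρ] ≤ 1 such that ⟨x,u|ρ|x',u'⟩ = 0 whenever x ≠ x' (X is classical). Let v₁ ∈ ℂ^d be a unit vector and let ρ' = (I_X ⊗ (I − v₁v₁†)) ρ (I_X ⊗ (I − v₁v₁†)). Then for every unit vector v ∈ ℂ^d with Tr[ρ'_{X|v}] > 0, there exists a unit vector v' ∈ ℂ^d with ⟨v₁, v'⟩ = 0 such that P^{ρ'}_{X|v} = P^{ρ}_{X|v'} = P^{ρ'}_{X|v'}. -/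

import Mathlib

open scoped ComplexOrder Classical
open Matrix

noncomputable section

/-- The conditional block `ρ_{X|v} = (I_X ⊗ ⟨v|) ρ (I_X ⊗ |v⟩)`. -/
def condX {X : Type*} {d : ℕ} [Fintype X] (ρ : Matrix (X × Fin d) (X × Fin d) ℂ)
    (v : Fin d → ℂ) : Matrix X X ℂ :=
  Matrix.of fun x x' => ∑ u : Fin d, ∑ u' : Fin d, star (v u) * ρ (x, u) (x', u') * v u'

/-- The induced distribution `P^ρ_{X|v} = diag(ρ_{X|v})/Tr[ρ_{X|v}]` on `X`
(junk value `0` when the trace vanishes). -/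
def distOf {X : Type*} [Fintype X] (σ : Matrix X X ℂ) : X → ℝ :=
  fun x => (σ x x).re / σ.trace.re

/-- A unit vector of `ℂ^d`. -/
def IsUnitVec {d : ℕ} (v : Fin d → ℂ) : Prop :=
  (∑ u, Complex.normSq (v u)) = 1

/-- The `d × d` block of `ρ` at position `(x, x')`. -/
def regBlock {X : Type*} {d : ℕ} (ρ : Matrix (X × Fin d) (X × Fin d) ℂ) (x x' : X) :
    Matrix (Fin d) (Fin d) ℂ :=
  ρ.submatrix (Prod.mk x) (Prod.mk x')

lemma condX_apply_eq_dotProduct {X : Type*} {d : ℕ} [Fintype X]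
    (ρ : Matrix (X × Fin d) (X × Fin d) ℂ) (v : Fin d → ℂ) (x x' : X) :
    condX ρ v x x' = star v ⬝ᵥ (regBlock ρ x x' *ᵥ v) := by
  simp [condX, regBlock, dotProduct, mulVec, Finset.mul_sum, mul_assoc]

lemma regBlock_conj {X : Type*} {d : ℕ} [Fintype X] [DecidableEq X]
    (A : Matrix (Fin d) (Fin d) ℂ) (ρ : Matrix (X × Fin d) (X × Fin d) ℂ) (x x' : X) :
    regBlock ((Matrix.of fun p q : X × Fin d => if p.1 = q.1 then A p.2 q.2 else 0) * ρ *
      (Matrix.of fun p q : X × Fin d => if p.1 = q.1 then A p.2 q.2 else 0)) x x' =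
    A * regBlock ρ x x' * A := by
  ext u u'
  simp only [regBlock, submatrix_apply, mul_apply, Fintype.sum_prod_type, of_apply, ite_mul,
    mul_ite, zero_mul, mul_zero]
  rw [Finset.sum_eq_single x' (by intro b _ hb; simp [hb]) (by simp)]
  refine Finset.sum_congr rfl fun b _ => ?_
  rw [if_pos rfl, Finset.sum_eq_single x (by intro c _ hc; simp [hc.symm]) (by simp)]
  simp

/-- Conjugating by `I ⊗ A` with `A` Hermitian amounts to applying `A` to the conditioning vector. -/
lemma condX_conj {X : Type*} {d : ℕ} [Fintype X] [DecidableEq X]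
    {A : Matrix (Fin d) (Fin d) ℂ} (hA : A.IsHermitian)
    (ρ : Matrix (X × Fin d) (X × Fin d) ℂ) (v : Fin d → ℂ) :
    condX ((Matrix.of fun p q : X × Fin d => if p.1 = q.1 then A p.2 q.2 else 0) * ρ *
      (Matrix.of fun p q : X × Fin d => if p.1 = q.1 then A p.2 q.2 else 0)) v =
    condX ρ (A *ᵥ v) := by
  ext x x'
  rw [condX_apply_eq_dotProduct, condX_apply_eq_dotProduct, regBlock_conj, star_mulVec, hA.eq,
    ← dotProduct_mulVec, mulVec_mulVec, mulVec_mulVec, mul_assoc]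

lemma condX_smul {X : Type*} {d : ℕ} [Fintype X] (ρ : Matrix (X × Fin d) (X × Fin d) ℂ)
    (r : ℝ) (v : Fin d → ℂ) :
    condX ρ ((r : ℂ) • v) = ((r ^ 2 : ℝ) : ℂ) • condX ρ v := by
  ext x x'
  rw [Matrix.smul_apply, condX_apply_eq_dotProduct, condX_apply_eq_dotProduct, mulVec_smul,
    dotProduct_smul, star_smul, smul_dotProduct]
  simp [smul_eq_mul, pow_two, mul_assoc]

lemma distOf_smul {X : Type*} [Fintype X] {r : ℝ} (hr : r ≠ 0) (σ : Matrix X X ℂ) :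
    distOf ((r : ℂ) • σ) = distOf σ := by
  ext x
  simp only [distOf, trace_smul, Matrix.smul_apply, smul_eq_mul, Complex.re_ofReal_mul]
  exact mul_div_mul_left _ _ hr

lemma isUnitVec_iff_dotProduct {d : ℕ} (v : Fin d → ℂ) : IsUnitVec v ↔ star v ⬝ᵥ v = 1 := by
  rw [IsUnitVec, ← Complex.ofReal_inj]
  simp [dotProduct, Complex.normSq_eq_conj_mul_self]

lemma exists_pos_smul_isUnitVec {d : ℕ} {w : Fin d → ℂ} (hw : w ≠ 0) :
    ∃ r : ℝ, 0 < r ∧ IsUnitVec ((r : ℂ) • w) := by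
  obtain ⟨i, hi⟩ := Function.ne_iff.mp hw
  have hpos : 0 < ∑ u, Complex.normSq (w u) :=
    Finset.sum_pos' (fun u _ => Complex.normSq_nonneg _)
      ⟨i, Finset.mem_univ i, Complex.normSq_pos.mpr hi⟩
  refine ⟨(√(∑ u, Complex.normSq (w u)))⁻¹, by positivity, ?_⟩
  simp only [IsUnitVec, Pi.smul_apply, smul_eq_mul, Complex.normSq_mul, Complex.normSq_ofReal,
    ← Finset.mul_sum]
  rw [← mul_inv, Real.mul_self_sqrt hpos.le, inv_mul_cancel₀ hpos.ne']

/-- Projecting away a single direction `v₁`: for every unit vector `v` whose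
conditional block in the projected state has positive trace, there is a unit vector `v'`
orthogonal to `v₁` with `P^{ρ'}_{X|v} = P^{ρ}_{X|v'} = P^{ρ'}_{X|v'}`. -/
theorem projection_preserves_conditional_dist {X : Type*} [Fintype X] [DecidableEq X]
    {d : ℕ} (hd : 1 ≤ d)
    (ρ : Matrix (X × Fin d) (X × Fin d) ℂ) (hρ : ρ.PosSemidef) (htr : ρ.trace.re ≤ 1)
    (hcl : ∀ p q : X × Fin d, p.1 ≠ q.1 → ρ p q = 0)
    (v₁ : Fin d → ℂ) (hv₁ : IsUnitVec v₁)
    (ρ' : Matrix (X × Fin d) (X × Fin d) ℂ)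
    (hρ' : ρ' =
      (Matrix.of fun p q : X × Fin d =>
          if p.1 = q.1 then
            (if p.2 = q.2 then (1 : ℂ) else 0) - v₁ p.2 * star (v₁ q.2)
          else 0) * ρ *
      (Matrix.of fun p q : X × Fin d =>
          if p.1 = q.1 then
            (if p.2 = q.2 then (1 : ℂ) else 0) - v₁ p.2 * star (v₁ q.2)
          else 0)) :
    ∀ v : Fin d → ℂ, IsUnitVec v → 0 < (condX ρ' v).trace.re →
      ∃ v' : Fin d → ℂ, IsUnitVec v' ∧ (∑ u, star (v₁ u) * v' u) = 0 ∧
        (∀ x, distOf (condX ρ' v) x = distOf (condX ρ v') x) ∧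
        (∀ x, distOf (condX ρ v') x = distOf (condX ρ' v') x) := by
  intro v _ hpos
  set A : Matrix (Fin d) (Fin d) ℂ := 1 - vecMulVec v₁ (star v₁) with hAdef
  have hA : A.IsHermitian :=
    isHermitian_one.sub (by simp [IsHermitian, conjTranspose_vecMulVec])
  have hunit : star v₁ ⬝ᵥ v₁ = 1 := (isUnitVec_iff_dotProduct v₁).mp hv₁
  have hAv (z : Fin d → ℂ) : A *ᵥ z = z - (star v₁ ⬝ᵥ z) • v₁ := by
    simp [hAdef, sub_mulVec, vecMulVec_mulVec]
  have horth : star v₁ ⬝ᵥ (A *ᵥ v) = 0 := by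
    simp [hAv, dotProduct_sub, dotProduct_smul, hunit]
  have hcond (z : Fin d → ℂ) : condX ρ' z = condX ρ (A *ᵥ z) := by
    rw [hρ', ← condX_conj hA]
    simp only [hAdef, Matrix.sub_apply, one_apply, vecMulVec_apply, Pi.star_apply]
  have hne : A *ᵥ v ≠ 0 := by
    intro h0
    rw [hcond, h0] at hpos
    simp [condX, trace] at hpos
  obtain ⟨r, hr, hru⟩ := exists_pos_smul_isUnitVec hne
  have horth' : star v₁ ⬝ᵥ ((r : ℂ) • (A *ᵥ v)) = 0 := by rw [dotProduct_smul, horth, smul_zero]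
  refine ⟨(r : ℂ) • (A *ᵥ v), hru, horth', fun x => ?_, fun x => ?_⟩
  · rw [hcond, condX_smul, distOf_smul (pow_ne_zero 2 hr.ne')]
  · rw [hcond, hAv ((r : ℂ) • (A *ᵥ v)), horth', zero_smul, sub_zero]
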